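/- Let p and q be primes with p ≡ q ≡ 1 (mod 4) such that p is a quadratic residue modulo q. If the equation s² − pq·t² = −1 has a solution in integers s, t, then p is a fourth power modulo q if and only if q is a fourth power modulo p; that is, (∃u, u⁴ ≡ p (mod q)) ↔ (∃v, v⁴ ≡ q (mod p)). -/

import Mathlib

open scoped NumberTheorySymbols

/-- odd reciprocity -/
lemma qrs_R (q : ℕ) (hq4 : q % 4 = 1) (n : ℤ) (hn : Odd n) :
    J(n | q) = J((q : ℤ) | n.natAbs) := by
  have hqo : Odd q := by rw [Nat.odd_iff]; omega
  have h1 : J(-1 | q) = 1 := by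
    rw [jacobiSym.at_neg_one hqo, ZMod.χ₄_nat_one_mod_four hq4]
  have h2 : J(n | q) = J((n.natAbs : ℤ) | q) := by
    rcases Int.natAbs_eq n with h | h
    · rw [← h]
    · conv_lhs => rw [h]
      rw [← neg_one_mul, jacobiSym.mul_left, h1, one_mul]
  rw [h2, ← jacobiSym.quadratic_reciprocity_one_mod_four hq4 (Int.natAbs_odd.mpr hn)]

lemma qrs_sq (a : ℤ) (n : ℕ) (h : IsCoprime a (n : ℤ)) : J(a ^ 2 | n) = 1 :=
  jacobiSym.sq_one' (Int.isCoprime_iff_gcd_eq_one.mp h)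

lemma qrs_S (n : ℕ) (m u v : ℤ) (hd : (n : ℤ) ∣ m * v ^ 2 - u ^ 2)
    (hv : IsCoprime v (n : ℤ)) (hu : IsCoprime u (n : ℤ)) : J(m | n) = 1 := by
  have h : J(m * v ^ 2 | n) = J(u ^ 2 | n) :=
    jacobiSym.mod_left' (Int.emod_eq_emod_iff_emod_sub_eq_zero.mpr (Int.emod_eq_zero_of_dvd hd))
  rwa [jacobiSym.mul_left, qrs_sq _ _ hv, qrs_sq _ _ hu, mul_one] at h

/-- coprimality from primes -/
lemma qrs_cop (a b : ℤ) (h : ∀ r : ℕ, r.Prime → (r : ℤ) ∣ a → (r : ℤ) ∣ b → False) :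
    IsCoprime a b := by
  rw [Int.isCoprime_iff_gcd_eq_one]
  by_contra hne
  obtain ⟨r, hr, hrd⟩ := Nat.exists_prime_and_dvd hne
  have := Int.natCast_dvd_natCast.mpr hrd
  exact h r hr (this.trans (Int.gcd_dvd_left ..)) (this.trans (Int.gcd_dvd_right ..))

lemma qrs_H (m : ℤ) : ∀ (N : ℕ) (u v M : ℤ), Odd N → u ^ 2 + m * v ^ 2 = N * M →
    IsCoprime (N : ℤ) m →
    (∀ r : ℕ, r.Prime → (r : ℤ) ∣ N → (r : ℤ) ∣ v → ¬ (r : ℤ) ∣ M) → J(-m | N) = 1 := by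
  intro N
  induction N using Nat.strong_induction_on with
  | _ N ih =>
  intro u v M hodd heq hcop hr
  by_cases hc : IsCoprime v (N : ℤ)
  · apply qrs_S N (-m) u v ⟨-M, by linarith⟩ hc
    apply qrs_cop
    intro r hrp hru hrN
    have hrp' := Nat.prime_iff_prime_int.mp hrp
    have h1 : (r : ℤ) ∣ m * v ^ 2 := by
      have : m * v ^ 2 = N * M - u * u := by linarith
      rw [this]
      exact dvd_sub (hrN.mul_right _) (hru.mul_right _)
    rcases hrp'.dvd_or_dvd h1 with h | h
    · exact hrp'.not_isUnit (hcop.isUnit_of_dvd' hrN h)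
    · exact hrp'.not_isUnit (hc.isUnit_of_dvd' (hrp'.dvd_of_dvd_pow h) hrN)
  · have : ∃ r : ℕ, r.Prime ∧ (r : ℤ) ∣ v ∧ (r : ℤ) ∣ N := by
      by_contra hcon
      push Not at hcon
      exact hc (qrs_cop _ _ fun r a b c => hcon r a b c)
    obtain ⟨r, hrp, hrv, hrN⟩ := this
    have hrp' := Nat.prime_iff_prime_int.mp hrp
    have hru : (r : ℤ) ∣ u := by
      have : u ^ 2 = N * M - m * v * v := by linarith
      apply hrp'.dvd_of_dvd_pow (n := 2)
      rw [this]
      exact dvd_sub (hrN.mul_right _) (hrv.mul_left _)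
    have hrM := hr r hrp hrN hrv
    obtain ⟨u', rfl⟩ := hru
    obtain ⟨v', rfl⟩ := hrv
    have h2 : ((r : ℤ) ^ 2) ∣ N := by
      have hcp : IsCoprime ((r : ℤ) ^ 2) M := by
        apply IsCoprime.pow_left
        exact (hrp'.coprime_iff_not_dvd).mpr hrM
      exact hcp.dvd_of_dvd_mul_right ⟨u' ^ 2 + m * v' ^ 2, by rw [← heq]; ring⟩
    have h2' : r ^ 2 ∣ N := by exact_mod_cast h2
    obtain ⟨N', rfl⟩ := h2'
    have hr0 : 0 < r := hrp.pos
    have hN' : Odd N' := (Nat.odd_mul.mp hodd).2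
    have hro : Odd (r ^ 2) := (Nat.odd_mul.mp hodd).1
    have hN'0 : 0 < N' := hN'.pos
    have hlt : N' < r ^ 2 * N' := by nlinarith [hrp.two_le, Nat.mul_le_mul hrp.two_le hrp.two_le]
    push_cast at heq hcop hr
    have hrz : ((r : ℤ)) ^ 2 ≠ 0 := by positivity
    have e := ih N' hlt u' v' M hN' (mul_left_cancel₀ hrz (by linarith)) hcop.of_mul_left_right
      (fun r' h1 h2 h3 => hr r' h1 (h2.mul_left _) (h3.mul_left _))
    have : NeZero (r ^ 2) := ⟨by positivity⟩
    have : NeZero N' := ⟨by positivity⟩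
    rw [jacobiSym.mul_right, e, mul_one, jacobiSym.pow_right]
    apply jacobiSym.sq_one
    rw [← Int.isCoprime_iff_gcd_eq_one]
    exact (hcop.of_mul_left_left.of_isCoprime_of_dvd_left (dvd_pow_self _ two_ne_zero)).symm.neg_left

lemma qrs_pcop (p : ℕ) (hp : p.Prime) (a : ℤ) (h : ¬ (p : ℤ) ∣ a) : IsCoprime a (p : ℤ) :=
  ((Nat.prime_iff_prime_int.mp hp).coprime_iff_not_dvd.mpr h).symm

/-- The Pell lemma. -/
lemma qrs_pell (p q : ℕ) (hp : p.Prime) (hq : q.Prime)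
    (hp4 : p % 4 = 1) (hq4 : q % 4 = 1) (hpq : J((q : ℤ) | p) = 1)
    (s t c d : ℤ) (hst : s ^ 2 - ((p : ℤ) * (q : ℤ)) * t ^ 2 = -1)
    (hcd : (q : ℤ) = c ^ 2 + d ^ 2) (hc : Odd c) (hd : Even d) (hdiv : (q : ℤ) ∣ c * s - d) :
    J(c + d * s | p) = 1 := by
  have hp' := Nat.prime_iff_prime_int.mp hp
  have hq' := Nat.prime_iff_prime_int.mp hq
  have hq0 : (q : ℤ) ≠ 0 := hq'.ne_zero
  obtain ⟨D, hD⟩ := hdiv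
  have hse : Even s := by
    by_contra hso
    rw [Int.not_even_iff_odd] at hso
    obtain ⟨k, rfl⟩ := hso
    have h1 : ((p : ℤ) * q) % 4 = 1 := by
      rw [Int.mul_emod]; have : (p : ℤ) % 4 = 1 := by omega
      have : (q : ℤ) % 4 = 1 := by omega
      rw [‹(p : ℤ) % 4 = 1›, this]; rfl
    obtain ⟨m, hm⟩ : ∃ m, (p : ℤ) * q = 4 * m + 1 := ⟨(p : ℤ) * q / 4, by omega⟩
    rw [hm] at hst
    rcases Int.even_or_odd' t with ⟨l, rfl | rfl⟩ <;> ring_nf at hst <;> omega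
  have hdvd : (q : ℤ) ∣ c + d * s := by
    have h : (q : ℤ) ∣ (c + d * s) ^ 2 := by
      refine ⟨p * q * t ^ 2 - q * D ^ 2, ?_⟩
      have e : (c + d * s) ^ 2 + (c * s - d) ^ 2 = (c ^ 2 + d ^ 2) * (s ^ 2 + 1) := by ring
      rw [← hcd, hD] at e
      have : s ^ 2 + 1 = p * q * t ^ 2 := by linarith
      rw [this] at e
      linear_combination e
    exact hq'.dvd_of_dvd_pow h
  obtain ⟨C, hC⟩ := hdvd
  have h1 : c * C - d * D = 1 := by
    apply mul_left_cancel₀ hq0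
    linear_combination (-c) * hC + d * hD - hcd
  have h2 : C ^ 2 + D ^ 2 = p * t ^ 2 := by
    apply mul_left_cancel₀ (pow_ne_zero 2 hq0)
    linear_combination (-(q * C) - (c + d * s)) * hC + (-(q * D) - (c * s - d)) * hD
      - (s ^ 2 + 1) * hcd + q * hst
  have hqo : ¬ Even (q : ℤ) := by
    rw [Int.not_even_iff]; omega
  have hCo : Odd C := by
    have : Odd ((q : ℤ) * C) := by
      rw [← hC]; exact hc.add_even (hd.mul_right _)
    exact (Int.odd_mul.mp this).2
  have hCD : IsCoprime C D := ⟨c, -d, by linarith⟩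
  rw [hC, jacobiSym.mul_left, hpq, one_mul, qrs_R p hp4 C hCo]
  have hCt : IsCoprime t C := by
    apply qrs_cop
    intro r hr ht hC
    have hr' := Nat.prime_iff_prime_int.mp hr
    have : (r : ℤ) ∣ D ^ 2 := by
      have : D ^ 2 = p * t * t - C * C := by linarith
      rw [this]
      exact dvd_sub (ht.mul_left _) (hC.mul_left _)
    exact hr'.not_isUnit (hCD.isUnit_of_dvd' hC (hr'.dvd_of_dvd_pow this))
  have aux : ∀ z : ℤ, IsCoprime z C → IsCoprime z (C.natAbs : ℤ) := by
    intro z hz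
    rw [Int.isCoprime_iff_gcd_eq_one] at *
    simpa only [Int.gcd, Int.natAbs_natCast] using hz
  apply qrs_S _ _ D t _ (aux _ hCt) (aux _ hCD.symm)
  rw [Int.natAbs_dvd]
  exact ⟨C, by linarith⟩

/-- values of `J(z | p)` and `J(2 | p)` -/
lemma qrs_z (p : ℕ) (hp4 : p % 4 = 1) (x y z m : ℤ) (hm : m % 4 = 1)
    (hz : Even z) (hz0 : z ≠ 0) (hy : Odd y) (hx : Odd x)
    (h : x ^ 2 = p * y ^ 2 + m * z ^ 2) (hxz : IsCoprime x z) (hyz : IsCoprime y z) :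
    J(z | p) = J(2 | p) ∧ J(2 | p) = if z % 4 = 0 then 1 else -1 := by
  have hpo : Odd p := by rw [Nat.odd_iff]; omega
  have h2 : J(2 | p) = if z % 4 = 0 then 1 else -1 := by
    rw [jacobiSym.at_two hpo, ZMod.χ₈_nat_eq_if_mod_eight, if_neg (by omega)]
    obtain ⟨k, rfl⟩ := hz
    obtain ⟨X, hX⟩ : ∃ X, x ^ 2 = 8 * X + 1 := ⟨x ^ 2 / 8, by
      have := Int.sq_mod_four_eq_one_of_odd hx
      have := Int.eight_dvd_sq_sub_one_of_odd hx
      omega⟩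
    obtain ⟨Y, hY⟩ : ∃ Y, y ^ 2 = 8 * Y + 1 := ⟨y ^ 2 / 8, by
      have := Int.eight_dvd_sq_sub_one_of_odd hy
      omega⟩
    obtain ⟨m', rfl⟩ : ∃ m', m = 4 * m' + 1 := ⟨m / 4, by omega⟩
    rw [hX, hY] at h
    rcases Int.even_or_odd' k with ⟨l, rfl | rfl⟩
    all_goals
      ring_nf at h
      split_ifs <;> omega
  have key : ∀ z' : ℤ, Odd z' → z' ∣ z → J(z' | p) = 1 := by
    intro z' ho hd
    rw [qrs_R p hp4 z' ho]
    have aux : ∀ w : ℤ, IsCoprime w z → IsCoprime w (z'.natAbs : ℤ) := by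
      intro w hw
      have := hw.of_isCoprime_of_dvd_right hd
      rw [Int.isCoprime_iff_gcd_eq_one] at *
      simpa only [Int.gcd, Int.natAbs_natCast] using this
    apply qrs_S _ _ x y _ (aux _ hyz) (aux _ hxz)
    rw [Int.natAbs_dvd]
    have : (p : ℤ) * y ^ 2 - x ^ 2 = z * (-m * z) := by rw [h]; ring
    rw [this]
    exact hd.mul_right _
  refine ⟨?_, h2⟩
  by_cases h4 : z % 4 = 0
  · rw [if_pos h4] at h2
    obtain ⟨l, z', hz', hzz⟩ : ∃ (l : ℕ) (z' : ℤ), Odd z' ∧ z = 2 ^ l * z' := by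
      obtain ⟨l, z', h1, h2⟩ := (Int.finiteMultiplicity_iff.mpr ⟨by decide, hz0⟩ :
        FiniteMultiplicity (2 : ℤ) z).exists_eq_pow_mul_and_not_dvd |>.imp (fun z' h => h)
        |> fun ⟨z', h1, h2⟩ => (⟨_, z', h1, h2⟩ : ∃ (l : ℕ) (z' : ℤ), z = 2 ^ l * z' ∧ ¬ 2 ∣ z')
      exact ⟨l, z', by rw [Int.odd_iff]; omega, h1⟩
    rw [h2]
    conv_lhs => rw [hzz]
    rw [jacobiSym.mul_left, jacobiSym.pow_left, h2, one_pow, one_mul]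
    exact key z' hz' (hzz ▸ Dvd.intro_left _ rfl)
  · obtain ⟨k, hk⟩ := hz
    have hk' : z = 2 * k := by omega
    conv_lhs => rw [hk']
    rw [jacobiSym.mul_left, key k (by rw [Int.odd_iff]; omega) ⟨2, by omega⟩, mul_one]

/-- a primitive solution of the Legendre equation -/
structure QrsSol (p q : ℕ) (x y z : ℤ) : Prop where
  eq : x ^ 2 = p * y ^ 2 + q * z ^ 2
  pos : 0 < x
  xy : IsCoprime x y
  xz : IsCoprime x z
  yz : IsCoprime y z
  px : ¬ (p : ℤ) ∣ x
  qx : ¬ (q : ℤ) ∣ x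
  qy : ¬ (q : ℤ) ∣ y
  pz : ¬ (p : ℤ) ∣ z

lemma qrs_main (p q : ℕ) (hp : p.Prime) (hq : q.Prime)
    (hp4 : p % 4 = 1) (hq4 : q % 4 = 1) (hpq : J((q : ℤ) | p) = 1)
    (s t : ℤ) (hst : s ^ 2 - ((p : ℤ) * (q : ℤ)) * t ^ 2 = -1)
    (x y z : ℤ) (h : QrsSol p q x y z) (hx : Odd x) (hy : Odd y) (hz : Even z) :
    J(x * y | q) * J(x * z | p) = 1 := by
  have hp' := Nat.prime_iff_prime_int.mp hp
  have hq' := Nat.prime_iff_prime_int.mp hq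
  have hpo : Odd p := by rw [Nat.odd_iff]; omega
  have heq := h.eq
  have hxpos := h.pos
  have hz0 : z ≠ 0 := by rintro rfl; exact h.pz (dvd_zero _)
  have hy0 : y ≠ 0 := by rintro rfl; exact h.qy (dvd_zero _)
  obtain ⟨hJz, hJ2⟩ := qrs_z p hp4 x y z q (by omega) hz hz0 hy hx h.eq h.xz h.yz
  have natAbs_cop : ∀ w n : ℤ, IsCoprime w n → IsCoprime w (n.natAbs : ℤ) := by
    intro w n hw
    rw [Int.isCoprime_iff_gcd_eq_one] at *
    simpa only [Int.gcd, Int.natAbs_natCast] using hw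
  -- `J(y|q) = 1`
  have hJy : J(y | q) = 1 := by
    rw [qrs_R q hq4 y hy]
    apply qrs_S _ _ x z _ (natAbs_cop _ _ h.yz.symm) (natAbs_cop _ _ h.xy)
    rw [Int.natAbs_dvd]
    exact ⟨-p * y, by rw [heq]; ring⟩
  -- choose c, d
  obtain ⟨c, d, hcd, hc, hd, hdiv, hpN⟩ : ∃ c d : ℤ, (q : ℤ) = c ^ 2 + d ^ 2 ∧ Odd c ∧ Even d ∧
      (q : ℤ) ∣ c * s - d ∧ ¬ (p : ℤ) ∣ x + c * z := by
    have : ∃ c d : ℤ, (q : ℤ) = c ^ 2 + d ^ 2 ∧ Odd c ∧ Even d := by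
      have := Fact.mk hq
      obtain ⟨a, b, hab⟩ := Nat.Prime.sq_add_sq (p := q) (by omega)
      have hab' : (q : ℤ) = (a : ℤ) ^ 2 + (b : ℤ) ^ 2 := by exact_mod_cast hab.symm
      have hqm : (q : ℤ) % 4 = 1 := by omega
      rcases Int.even_or_odd (a : ℤ) with ha | ha <;> rcases Int.even_or_odd (b : ℤ) with hb | hb
      · obtain ⟨k, hk⟩ := ha; obtain ⟨l, hl⟩ := hb
        rw [hk, hl] at hab'; ring_nf at hab'; omega
      · exact ⟨b, a, by linarith, hb, ha⟩
      · exact ⟨a, b, by linarith, ha, hb⟩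
      · have := Int.sq_mod_four_eq_one_of_odd ha
        have := Int.sq_mod_four_eq_one_of_odd hb
        omega
    obtain ⟨c, d, hcd, hc, hd⟩ := this
    have : ∃ d : ℤ, (q : ℤ) = c ^ 2 + d ^ 2 ∧ Even d ∧ (q : ℤ) ∣ c * s - d := by
      have hprod : (q : ℤ) ∣ (c * s - d) * (c * s - (-d)) :=
        ⟨c ^ 2 * p * t ^ 2 - 1, by linear_combination c ^ 2 * hst + hcd⟩
      rcases hq'.dvd_or_dvd hprod with h | h
      · exact ⟨d, hcd, hd, h⟩
      · exact ⟨-d, by rw [hcd]; ring, hd.neg, h⟩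
    obtain ⟨d, hcd, hd, hdiv⟩ := this
    by_cases hN : (p : ℤ) ∣ x + c * z
    · refine ⟨-c, -d, by rw [hcd]; ring, hc.neg, hd.neg, ?_, ?_⟩
      · have : -c * s - -d = -(c * s - d) := by ring
        rw [this]; exact hdiv.neg_right
      · intro hN2
        have h2 : (p : ℤ) ∣ 2 * x := by
          have := dvd_add hN hN2
          have e : x + c * z + (x + -c * z) = 2 * x := by ring
          rwa [e] at this
        rcases hp'.dvd_or_dvd h2 with h3 | h3
        · have := Int.le_of_dvd (by norm_num) h3
          have := hp.two_le
          omega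
        · exact h.px h3
    · exact ⟨c, d, hcd, hc, hd, hdiv, hN⟩
  have hJcd := qrs_pell p q hp hq hp4 hq4 hpq s t c d hst hcd hc hd hdiv
  -- N
  have hNpos : 0 < x + c * z := by
    have hp0 : (0 : ℤ) < p := by exact_mod_cast hp.pos
    have hlt : (c * z) ^ 2 < x ^ 2 := by
      have : 0 < (p : ℤ) * y ^ 2 := by positivity
      rw [heq, hcd]
      nlinarith [sq_nonneg (d * z)]
    have := (abs_lt.mp (abs_lt_of_sq_lt_sq hlt hxpos.le)).1
    linarith
  obtain ⟨N, hN⟩ := Int.eq_ofNat_of_zero_le hNpos.le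
  have hNodd' : Odd (x + c * z) := hx.add_even (hz.mul_left _)
  have hNodd : Odd N := by rw [hN] at hNodd'; exact_mod_cast hNodd'
  have hNp : IsCoprime (N : ℤ) (p : ℤ) := qrs_pcop p hp _ (by rwa [← hN])
  have hH : J(-(p : ℤ) | N) = 1 := by
    apply qrs_H (p : ℤ) N (d * z) y (x - c * z) hNodd _ hNp
    · intro r hr h1 h2 h3
      have hr' := Nat.prime_iff_prime_int.mp hr
      have h4 : (r : ℤ) ∣ 2 * x := by
        have := dvd_add h1 h3
        rw [← hN] at this
        have e : x + c * z + (x - c * z) = 2 * x := by ring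
        rwa [e] at this
      rcases hr'.dvd_or_dvd h4 with h5 | h5
      · have h6 : r ∣ 2 := by exact_mod_cast h5
        have h7 : r = 2 := (Nat.prime_dvd_prime_iff_eq hr Nat.prime_two).mp h6
        subst h7
        have h8 : 2 ∣ N := by exact_mod_cast h1
        rw [Nat.odd_iff] at hNodd
        omega
      · exact hr'.not_isUnit (h.xy.isUnit_of_dvd' h5 h2)
    · rw [← hN]
      linear_combination -heq - z ^ 2 * hcd
  have hJN : J((N : ℤ) | p) = J(-1 | N) := by
    rw [← jacobiSym.quadratic_reciprocity_one_mod_four hp4 hNodd]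
    have : (p : ℤ) = (-1) * (-p) := by ring
    rw [this, jacobiSym.mul_left, hH, mul_one]
  have hpcd : ¬ (p : ℤ) ∣ c + d * s := by
    intro hdv
    have : J(c + d * s | p) = 0 := by
      rw [jacobiSym.eq_zero_iff]
      refine ⟨hp.ne_zero, fun h1 => ?_⟩
      exact hp'.not_isUnit ((Int.isCoprime_iff_gcd_eq_one.mpr h1).isUnit_of_dvd' hdv dvd_rfl)
    omega
  have hp2 : ¬ (p : ℤ) ∣ 2 := by
    intro h3
    have := Int.le_of_dvd (by norm_num) h3
    have := hp.two_le
    omega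
  have hJ1 : J(2 * z * (N : ℤ) * (c + d * s) | p) = 1 := by
    have hdv : (p : ℤ) ∣ (2 * z * (N : ℤ) * (c + d * s)) * 1 ^ 2 - ((x + c * z) + d * s * z) ^ 2 := by
      refine ⟨- (y ^ 2 + d ^ 2 * z ^ 2 * q * t ^ 2), ?_⟩
      rw [← hN]
      linear_combination -heq - d ^ 2 * z ^ 2 * hst - z ^ 2 * hcd
    refine qrs_S _ _ _ 1 hdv isCoprime_one_left (qrs_pcop p hp _ fun hd1 => ?_)
    have hd2 : (p : ℤ) ∣ 2 * z * (N : ℤ) * (c + d * s) := by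
      have := dvd_add hdv (hd1.pow two_ne_zero |>.trans dvd_rfl)
      simpa using this
    rcases hp'.dvd_or_dvd hd2 with h1 | h1
    · rcases hp'.dvd_or_dvd h1 with h1 | h1
      · rcases hp'.dvd_or_dvd h1 with h1 | h1
        · exact hp2 h1
        · exact h.pz h1
      · exact hpN (hN ▸ h1)
    · exact hpcd h1
  rw [jacobiSym.mul_left, jacobiSym.mul_left, jacobiSym.mul_left, hJcd, hJN, hJz, hJ2,
    jacobiSym.at_neg_one hNodd, ZMod.χ₄_nat_eq_if_mod_four] at hJ1
  have hN1 : (N : ℤ) % 4 = 1 := by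
    by_contra hne
    rw [Nat.odd_iff] at hNodd
    have e1 : ¬ N % 2 = 0 := by omega
    have e2 : ¬ N % 4 = 1 := by omega
    simp only [e1, e2, if_false] at hJ1
    split_ifs at hJ1 <;> norm_num at hJ1
  -- the factor at x
  obtain ⟨X, hX⟩ := Int.eq_ofNat_of_zero_le hxpos.le
  have hXodd : Odd X := by rw [hX] at hx; exact_mod_cast hx
  have hJx : J(-((p : ℤ) * q) | X) = 1 := by
    have hyX : IsCoprime y (X : ℤ) := hX ▸ h.xy.symm
    have hqX : IsCoprime ((q : ℤ) * z) (X : ℤ) := by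
      rw [← hX]
      exact (qrs_pcop q hq x h.qx).symm.mul_left h.xz.symm
    refine qrs_S _ _ _ _ ?_ hyX hqX
    rw [← hX]
    exact ⟨-q * x, by linear_combination (q : ℤ) * heq⟩
  have hJxx : J(x | q) * J(x | p) = J(-1 | X) := by
    rw [hX, ← jacobiSym.quadratic_reciprocity_one_mod_four hp4 hXodd,
      ← jacobiSym.quadratic_reciprocity_one_mod_four hq4 hXodd, mul_comm, ← jacobiSym.mul_left]
    have : (p : ℤ) * q = (-1) * (-(p * q)) := by ring
    rw [this, jacobiSym.mul_left, hJx, mul_one]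
  rw [jacobiSym.mul_left, jacobiSym.mul_left, hJy, mul_one, ← mul_assoc, hJxx, hJz, hJ2,
    jacobiSym.at_neg_one hXodd, ZMod.χ₄_nat_eq_if_mod_four]
  obtain ⟨k, rfl⟩ := hz
  obtain ⟨l, rfl⟩ := hc
  have e : (2 * l + 1) * (k + k) = 4 * (l * k) + 2 * k := by ring
  rw [e] at hN
  rw [Nat.odd_iff] at hXodd
  split_ifs <;> first | rfl | omega

lemma qrs_quartic (p q : ℕ) (hq : q.Prime) (hq4 : q % 4 = 1) (x y m : ℤ)
    (heq : x ^ 2 = p * y ^ 2 + q * m) (hx : ¬ (q : ℤ) ∣ x) (hy : ¬ (q : ℤ) ∣ y) :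
    (∃ u : ℤ, u ^ 4 ≡ (p : ℤ) [ZMOD (q : ℤ)]) ↔ J(x * y | q) = 1 := by
  have := Fact.mk hq
  have hx' : (x : ZMod q) ≠ 0 := by rwa [Ne, ZMod.intCast_zmod_eq_zero_iff_dvd]
  have hy' : (y : ZMod q) ≠ 0 := by rwa [Ne, ZMod.intCast_zmod_eq_zero_iff_dvd]
  have he : (x : ZMod q) ^ 2 = (p : ZMod q) * (y : ZMod q) ^ 2 := by
    have := congrArg (Int.cast : ℤ → ZMod q) heq
    push_cast at this
    simpa using this
  rw [← jacobiSym.legendreSym.to_jacobiSym, legendreSym.eq_one_iff q (by push_cast; positivity)]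
  push_cast
  constructor
  · rintro ⟨u, hu⟩
    have hu' : (u : ZMod q) ^ 4 = p := by
      have := (ZMod.intCast_eq_intCast_iff _ _ q).mpr hu
      push_cast at this
      exact this
    obtain ⟨i, hi⟩ : IsSquare (-1 : ZMod q) := ZMod.exists_sq_eq_neg_one_iff.mpr (by omega)
    have h0 : ((x : ZMod q) - (u : ZMod q) ^ 2 * y) * (x + (u : ZMod q) ^ 2 * y) = 0 := by
      linear_combination he - (y : ZMod q) ^ 2 * hu'
    rcases mul_eq_zero.mp h0 with h | h
    · exact ⟨u * y, by linear_combination (y : ZMod q) * h⟩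
    · exact ⟨i * u * y, by linear_combination (y : ZMod q) * h + (u : ZMod q) ^ 2 * y ^ 2 * hi⟩
  · rintro ⟨k, hk⟩
    obtain ⟨v, hv⟩ := ZMod.intCast_surjective (k / y : ZMod q)
    refine ⟨v, (ZMod.intCast_eq_intCast_iff _ _ q).mp ?_⟩
    push_cast
    rw [hv]
    field_simp
    linear_combination (-(k * k) - (x : ZMod q) * y) * hk + (y : ZMod q) ^ 2 * he

lemma qrs_box (p q : ℕ) (hp : p.Prime) (hq : q.Prime) (hne : p ≠ q)
    (w w' : ℤ) (hw : w ^ 2 ≡ (p : ℤ) [ZMOD (q : ℤ)]) (hw' : w' ^ 2 ≡ (q : ℤ) [ZMOD (p : ℤ)]) :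
    ∃ x y z : ℤ, x ^ 2 = p * y ^ 2 + q * z ^ 2 ∧ (x ≠ 0 ∨ y ≠ 0 ∨ z ≠ 0) := by
  have hp' := Nat.prime_iff_prime_int.mp hp
  have hq' := Nat.prime_iff_prime_int.mp hq
  have hp0 : (0 : ℤ) < p := by exact_mod_cast hp.pos
  have hq0 : (0 : ℤ) < q := by exact_mod_cast hq.pos
  have := Fact.mk hp
  have := Fact.mk hq
  let B := Finset.range (Nat.sqrt (p * q) + 1) ×ˢ Finset.range (Nat.sqrt q + 1) ×ˢ
    Finset.range (Nat.sqrt p + 1)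
  let f : ℕ × ℕ × ℕ → ZMod q × ZMod p := fun a =>
    ((a.1 : ZMod q) - (w : ZMod q) * a.2.1, (a.1 : ZMod p) - (w' : ZMod p) * a.2.2)
  have hcard : (Finset.univ : Finset (ZMod q × ZMod p)).card < B.card := by
    simp only [B, Finset.card_product, Finset.card_range, Finset.card_univ, Fintype.card_prod,
      ZMod.card]
    have h1 := Nat.lt_succ_sqrt (p * q)
    have h2 := Nat.lt_succ_sqrt p
    have h3 := Nat.lt_succ_sqrt q
    simp only [Nat.succ_eq_add_one] at h1 h2 h3
    set a := Nat.sqrt (p * q) + 1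
    set b := Nat.sqrt q + 1
    set c := Nat.sqrt p + 1
    have h4 : p * q < (c * c) * (b * b) := Nat.mul_lt_mul'' h2 h3
    have h5 : (p * q) * (p * q) < (a * a) * ((c * c) * (b * b)) := Nat.mul_lt_mul'' h1 h4
    by_contra hcon
    push Not at hcon
    have := Nat.mul_le_mul hcon hcon
    nlinarith
  obtain ⟨⟨x1, y1, z1⟩, h1, ⟨x2, y2, z2⟩, h2, hne12, hf⟩ :=
    Finset.exists_ne_map_eq_of_card_lt_of_maps_to hcard (f := f) (fun a _ => Finset.mem_univ _)
  simp only [B, Finset.mem_product, Finset.mem_range, Nat.lt_succ_iff] at h1 h2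
  simp only [f, Prod.mk.injEq] at hf
  have bound : ∀ n a b : ℕ, a ≤ Nat.sqrt n → b ≤ Nat.sqrt n → ((a : ℤ) - b) ^ 2 ≤ n := by
    intro n a b ha hb
    have h3 : ((Nat.sqrt n : ℕ) : ℤ) * (Nat.sqrt n : ℕ) ≤ n := by exact_mod_cast Nat.sqrt_le n
    have ha' : (a : ℤ) ≤ Nat.sqrt n := by exact_mod_cast ha
    have hb' : (b : ℤ) ≤ Nat.sqrt n := by exact_mod_cast hb
    have : |(a : ℤ) - b| ≤ |((Nat.sqrt n : ℕ) : ℤ)| := by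
      rw [abs_of_nonneg (Int.natCast_nonneg (Nat.sqrt n)), abs_le]; constructor <;> omega
    have := sq_le_sq.mpr this
    nlinarith
  have bx := bound _ _ _ h1.1 h2.1
  have bY := bound _ _ _ h1.2.1 h2.2.1
  have bZ := bound _ _ _ h1.2.2 h2.2.2
  have hnz : ((x1 : ℤ) - x2 ≠ 0 ∨ (y1 : ℤ) - y2 ≠ 0 ∨ (z1 : ℤ) - z2 ≠ 0) := by
    by_contra hcon
    push Not at hcon
    apply hne12
    simp only [Prod.mk.injEq]
    omega
  have d1 : (q : ℤ) ∣ ((x1 : ℤ) - x2) - w * (y1 - y2) := by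
    rw [← ZMod.intCast_zmod_eq_zero_iff_dvd]
    push_cast
    linear_combination hf.1
  have d2 : (p : ℤ) ∣ ((x1 : ℤ) - x2) - w' * (z1 - z2) := by
    rw [← ZMod.intCast_zmod_eq_zero_iff_dvd]
    push_cast
    linear_combination hf.2
  generalize (x1 : ℤ) - x2 = x at *
  generalize (y1 : ℤ) - y2 = y at *
  generalize (z1 : ℤ) - z2 = z at *
  push_cast at bx
  have nsq : ∀ (r : ℕ), r.Prime → ∀ a : ℤ, a ^ 2 ≠ r := by
    intro r hr a ha
    have hr' := Nat.prime_iff_prime_int.mp hr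
    exact hr'.irreducible.not_isSquare ⟨a, by rw [← ha]; ring⟩
  have bY' : y ^ 2 < q := lt_of_le_of_ne bY (nsq q hq y)
  have bZ' : z ^ 2 < p := lt_of_le_of_ne bZ (nsq p hp z)
  have bx' : x ^ 2 < p * q := by
    apply lt_of_le_of_ne bx
    intro hx
    have h3 : (p : ℤ) ∣ x := hp'.dvd_of_dvd_pow (hx ▸ Dvd.intro _ rfl : (p : ℤ) ∣ x ^ 2)
    obtain ⟨k, rfl⟩ := h3
    have h4 : (p : ℤ) * k ^ 2 = q := mul_left_cancel₀ hp0.ne' (by linarith)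
    have h5 : (p : ℤ) ∣ q := ⟨_, h4.symm⟩
    exact hne ((Nat.prime_dvd_prime_iff_eq hp hq).mp (by exact_mod_cast h5))
  have hw1 := hw.symm.dvd
  have hw1' := hw'.symm.dvd
  have D1 : (q : ℤ) ∣ x ^ 2 - p * y ^ 2 - q * z ^ 2 := by
    have e : x ^ 2 - p * y ^ 2 - q * z ^ 2 = (x - w * y) * (x + w * y) + (w ^ 2 - p) * y ^ 2
      - q * z ^ 2 := by ring
    rw [e]
    exact dvd_sub (dvd_add (d1.mul_right _) (hw1.mul_right _)) (Dvd.intro _ rfl)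
  have D2 : (p : ℤ) ∣ x ^ 2 - p * y ^ 2 - q * z ^ 2 := by
    have e : x ^ 2 - p * y ^ 2 - q * z ^ 2 = (x - w' * z) * (x + w' * z) + (w' ^ 2 - q) * z ^ 2
      - p * y ^ 2 := by ring
    rw [e]
    exact dvd_sub (dvd_add (d2.mul_right _) (hw1'.mul_right _)) (Dvd.intro _ rfl)
  have hcop : IsCoprime (p : ℤ) (q : ℤ) :=
    Nat.isCoprime_iff_coprime.mpr ((Nat.coprime_primes hp hq).mpr hne)
  obtain ⟨k, hk⟩ := hcop.mul_dvd D2 D1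
  have hpq0 : (0 : ℤ) < p * q := by positivity
  have hk1 : k < 1 := by
    by_contra hc
    have : (p : ℤ) * q * 1 ≤ p * q * k := mul_le_mul_of_nonneg_left (by omega) hpq0.le
    nlinarith [mul_nonneg hp0.le (sq_nonneg y), mul_nonneg hq0.le (sq_nonneg z)]
  have hk2 : -2 < k := by
    by_contra hc
    have : (p : ℤ) * q * k ≤ p * q * (-2) := mul_le_mul_of_nonneg_left (by omega) hpq0.le
    have := mul_lt_mul_of_pos_left bY' hp0
    have := mul_lt_mul_of_pos_left bZ' hq0
    nlinarith [sq_nonneg x]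
  have hk3 : k = 0 ∨ k = -1 := by omega
  rcases hk3 with rfl | rfl
  · exact ⟨x, y, z, by linarith, hnz⟩
  · refine ⟨x ^ 2 + p * q, y * x + q * z, z * x - p * y, ?_, Or.inl (by positivity)⟩
    linear_combination (x ^ 2 + (p : ℤ) * q) * hk

lemma qrs_exists (p q : ℕ) (hp : p.Prime) (hq : q.Prime) (hne : p ≠ q)
    (w w' : ℤ) (hw : w ^ 2 ≡ (p : ℤ) [ZMOD (q : ℤ)]) (hw' : w' ^ 2 ≡ (q : ℤ) [ZMOD (p : ℤ)]) :
    ∃ x y z : ℤ, QrsSol p q x y z := by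
  have hp' := Nat.prime_iff_prime_int.mp hp
  have hq' := Nat.prime_iff_prime_int.mp hq
  have hp0 : (0 : ℤ) < p := by exact_mod_cast hp.pos
  have hq0 : (0 : ℤ) < q := by exact_mod_cast hq.pos
  have ex : ∃ n : ℕ, 0 < n ∧ ∃ y z : ℤ, (n : ℤ) ^ 2 = p * y ^ 2 + q * z ^ 2 := by
    obtain ⟨x, y, z, heq, hnz⟩ := qrs_box p q hp hq hne w w' hw hw'
    refine ⟨x.natAbs, ?_, y, z, by rw [Int.natAbs_sq, heq]⟩
    rw [Int.natAbs_pos]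
    rintro rfl
    have h1 : 0 ≤ (p : ℤ) * y ^ 2 := by positivity
    have h2 : 0 ≤ (q : ℤ) * z ^ 2 := by positivity
    have h3 : (p : ℤ) * y ^ 2 = 0 := by linarith
    have h4 : (q : ℤ) * z ^ 2 = 0 := by linarith
    simp [hp.ne_zero, hq.ne_zero] at h3 h4
    simp [h3, h4] at hnz
  classical
  obtain ⟨hn0, y, z, heq⟩ := Nat.find_spec ex
  have hmin := fun m => Nat.find_min ex (m := m)
  generalize Nat.find ex = n at *
  -- no common prime divisor of all three
  have hall : ∀ r : ℕ, r.Prime → (r : ℤ) ∣ n → (r : ℤ) ∣ y → (r : ℤ) ∣ z → False := by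
    intro r hr h1 h2 h3
    have hr0 : (r : ℤ) ≠ 0 := by exact_mod_cast hr.ne_zero
    have h1' : r ∣ n := by exact_mod_cast h1
    obtain ⟨n', rfl⟩ := h1'
    obtain ⟨y', rfl⟩ := h2
    obtain ⟨z', rfl⟩ := h3
    have hn' : 0 < n' := Nat.pos_of_mul_pos_left hn0
    apply hmin n' (by nlinarith [hr.two_le])
    refine ⟨hn', y', z', mul_left_cancel₀ (pow_ne_zero 2 hr0) ?_⟩
    push_cast at heq
    linarith
  have aux : ∀ (r l : ℕ), r.Prime → l.Prime → ∀ a : ℤ, ((r : ℤ) ^ 2) ∣ l * a ^ 2 → (r : ℤ) ∣ a := by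
    intro r l hr hl a h
    have hr' := Nat.prime_iff_prime_int.mp hr
    by_cases hrl : r = l
    · subst hrl
      rw [pow_two, mul_dvd_mul_iff_left hr'.ne_zero] at h
      exact hr'.dvd_of_dvd_pow h
    · have h1 : (r : ℤ) ∣ l * a ^ 2 := (dvd_pow_self _ two_ne_zero).trans h
      rcases hr'.dvd_or_dvd h1 with h2 | h2
      · exact absurd ((Nat.prime_dvd_prime_iff_eq hr hl).mp (by exact_mod_cast h2)) hrl
      · exact hr'.dvd_of_dvd_pow h2
  have hxy : IsCoprime (n : ℤ) y := qrs_cop _ _ fun r hr h1 h2 => hall r hr h1 h2 <| by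
    apply aux r q hr hq
    have e : (q : ℤ) * z ^ 2 = n ^ 2 - p * y ^ 2 := by linarith
    rw [e]
    exact dvd_sub (pow_dvd_pow_of_dvd h1 2) ((pow_dvd_pow_of_dvd h2 2).mul_left _)
  have hxz : IsCoprime (n : ℤ) z := qrs_cop _ _ fun r hr h1 h2 => hall r hr h1 (by
    apply aux r p hr hp
    have e : (p : ℤ) * y ^ 2 = n ^ 2 - q * z ^ 2 := by linarith
    rw [e]
    exact dvd_sub (pow_dvd_pow_of_dvd h1 2) ((pow_dvd_pow_of_dvd h2 2).mul_left _)) h2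
  have hyz : IsCoprime y z := qrs_cop _ _ fun r hr h1 h2 => hall r hr (by
    apply (Nat.prime_iff_prime_int.mp hr).dvd_of_dvd_pow (n := 2)
    rw [heq]
    exact dvd_add ((h1.pow two_ne_zero).mul_left _) ((h2.pow two_ne_zero).mul_left _)) h1 h2
  have hpq' : ¬ (p : ℤ) ∣ q := fun h => hne ((Nat.prime_dvd_prime_iff_eq hp hq).mp
    (by exact_mod_cast h))
  have hqp' : ¬ (q : ℤ) ∣ p := fun h => hne ((Nat.prime_dvd_prime_iff_eq hq hp).mp
    (by exact_mod_cast h)).symm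
  have hqx : ¬ (q : ℤ) ∣ n := by
    intro h1
    have h2 : (q : ℤ) ∣ p * y ^ 2 := by
      have e : (p : ℤ) * y ^ 2 = n ^ 2 - q * z ^ 2 := by linarith
      rw [e]
      exact dvd_sub (h1.pow two_ne_zero) (Dvd.intro _ rfl)
    rcases hq'.dvd_or_dvd h2 with h3 | h3
    · exact hqp' h3
    · exact hq'.not_isUnit (hxy.isUnit_of_dvd' h1 (hq'.dvd_of_dvd_pow h3))
  have hpx : ¬ (p : ℤ) ∣ n := by
    intro h1
    have h2 : (p : ℤ) ∣ q * z ^ 2 := by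
      have e : (q : ℤ) * z ^ 2 = n ^ 2 - p * y ^ 2 := by linarith
      rw [e]
      exact dvd_sub (h1.pow two_ne_zero) (Dvd.intro _ rfl)
    rcases hp'.dvd_or_dvd h2 with h3 | h3
    · exact hpq' h3
    · exact hp'.not_isUnit (hxz.isUnit_of_dvd' h1 (hp'.dvd_of_dvd_pow h3))
  refine ⟨n, y, z, heq, by exact_mod_cast hn0, hxy, hxz, hyz, hpx, hqx, ?_, ?_⟩
  · intro h1
    apply hqx
    apply hq'.dvd_of_dvd_pow (n := 2)
    rw [heq]
    exact dvd_add ((h1.pow two_ne_zero).mul_left _) (Dvd.intro _ rfl)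
  · intro h1
    apply hpx
    apply hp'.dvd_of_dvd_pow (n := 2)
    rw [heq]
    exact dvd_add (Dvd.intro _ rfl) ((h1.pow two_ne_zero).mul_left _)


/-- Let `p ≡ q ≡ 1 (mod 4)` be primes with `p` a quadratic residue
mod `q`.  If `s² - pq·t² = -1` has an integral solution, then `p` is a fourth power
mod `q` iff `q` is a fourth power mod `p`. -/
theorem quartic_residue_symmetry (p q : ℕ) (hp : p.Prime) (hq : q.Prime)
    (hp4 : p % 4 = 1) (hq4 : q % 4 = 1)
    (hres : ∃ w : ℤ, w ^ 2 ≡ (p : ℤ) [ZMOD (q : ℤ)])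
    (hsol : ∃ s t : ℤ, s ^ 2 - ((p : ℤ) * (q : ℤ)) * t ^ 2 = -1) :
    ((∃ u : ℤ, u ^ 4 ≡ (p : ℤ) [ZMOD (q : ℤ)]) ↔
     (∃ v : ℤ, v ^ 4 ≡ (q : ℤ) [ZMOD (p : ℤ)])) := by
  obtain ⟨w, hw⟩ := hres
  obtain ⟨s, t, hst⟩ := hsol
  by_cases hne : p = q
  · subst hne; rfl
  have hp' := Nat.prime_iff_prime_int.mp hp
  have hq' := Nat.prime_iff_prime_int.mp hq
  have hpo : Odd p := by rw [Nat.odd_iff]; omega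
  have hqo : Odd q := by rw [Nat.odd_iff]; omega
  have hqp' : ¬ (q : ℤ) ∣ p := fun h => hne ((Nat.prime_dvd_prime_iff_eq hq hp).mp
    (by exact_mod_cast h)).symm
  have hJpq : jacobiSym (p : ℤ) q = 1 := by
    have hd : (q : ℤ) ∣ (p : ℤ) * 1 ^ 2 - w ^ 2 := by simpa using hw.dvd
    refine qrs_S q p w 1 hd isCoprime_one_left (qrs_pcop q hq w fun h => hqp' ?_)
    have := dvd_add hd (h.pow two_ne_zero)
    simpa using this
  have hJqp : jacobiSym (q : ℤ) p = 1 := by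
    rw [← jacobiSym.quadratic_reciprocity_one_mod_four hp4 hqo]; exact hJpq
  obtain ⟨w', hw'⟩ : ∃ w' : ℤ, w' ^ 2 ≡ (q : ℤ) [ZMOD (p : ℤ)] := by
    haveI := Fact.mk hp
    obtain ⟨k, hk⟩ := ZMod.isSquare_of_jacobiSym_eq_one hJqp
    obtain ⟨v, rfl⟩ := ZMod.intCast_surjective k
    refine ⟨v, (ZMod.intCast_eq_intCast_iff _ _ p).mp ?_⟩
    rw [hk]; push_cast; ring
  obtain ⟨x, y, z, h⟩ := qrs_exists p q hp hq hne w w' hw hw'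
  have hprod : jacobiSym (x * y) q * jacobiSym (x * z) p = 1 := by
    have heq := h.eq
    obtain ⟨a, ha⟩ : ∃ a, (p : ℤ) = 4 * a + 1 := ⟨(p : ℤ) / 4, by omega⟩
    obtain ⟨b, hb⟩ : ∃ b, (q : ℤ) = 4 * b + 1 := ⟨(q : ℤ) / 4, by omega⟩
    have h2 : ¬ (2 ∣ y ∧ 2 ∣ z) := fun ⟨h1, h2⟩ =>
      Int.prime_two.not_isUnit (h.yz.isUnit_of_dvd' h1 h2)
    rw [ha, hb] at heq
    rcases Int.even_or_odd y with hy | hy <;> rcases Int.even_or_odd z with hz | hz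
    · exact absurd ⟨hy.two_dvd, hz.two_dvd⟩ h2
    · have hx : Odd x := by
        by_contra hx
        rw [Int.not_odd_iff_even] at hx
        obtain ⟨x, rfl⟩ := hx; obtain ⟨y, rfl⟩ := hy; obtain ⟨z, rfl⟩ := hz
        ring_nf at heq; omega
      rw [mul_comm]
      refine qrs_main q p hq hp hq4 hp4 hJpq s t (by linarith) x z y ?_ hx hz hy
      exact ⟨by rw [h.eq]; ring, h.pos, h.xz, h.xy, h.yz.symm, h.qx, h.px, h.pz, h.qy⟩
    · have hx : Odd x := by
        by_contra hx
        rw [Int.not_odd_iff_even] at hx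
        obtain ⟨x, rfl⟩ := hx; obtain ⟨y, rfl⟩ := hy; obtain ⟨z, rfl⟩ := hz
        ring_nf at heq; omega
      exact qrs_main p q hp hq hp4 hq4 hJqp s t hst x y z h hx hy hz
    · exfalso
      rcases Int.even_or_odd x with hx | hx <;>
        obtain ⟨x, rfl⟩ := hx <;> obtain ⟨y, rfl⟩ := hy <;> obtain ⟨z, rfl⟩ := hz <;>
        ring_nf at heq <;> omega
  rw [qrs_quartic p q hq hq4 x y (z ^ 2) h.eq h.qx h.qy,
    qrs_quartic q p hp hp4 x z (y ^ 2) (by rw [h.eq]; ring) h.px h.pz]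
  constructor <;> intro h1 <;> rw [h1] at hprod <;> linarith
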